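/- A finite multigraph Γ is eulerian (all valencies even) if and only if Γ has no separating edges and b₁(Γ) ∈ B_Γ. -/

import Mathlib

/-!
A finite multigraph on vertex type `V` with edge type `E`: each edge has a
(possibly diagonal, i.e. loop) unordered pair of endpoints in `Sym2 V`.
-/
structure Multigraph (V E : Type) where
  ends : E → Sym2 V

namespace Multigraph

variable {V E : Type} [Fintype V] [Fintype E] [DecidableEq V] [DecidableEq E]
variable (G : Multigraph V E)

/-- Valency of the vertex `v` in the subgraph with edge set `Δ`; a loop counts twice. -/
def deg (Δ : Finset E) (v : V) : ℕ :=
  ∑ e ∈ Δ, (if G.ends e = Sym2.diag v then 2 else if v ∈ G.ends e then 1 else 0)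

/-- `Δ` is a cyclic subgraph (even subset of edges): all valencies are even. -/
def IsCyclic (Δ : Finset E) : Prop := ∀ v, Even (G.deg Δ v)

instance (Δ : Finset E) : Decidable (G.IsCyclic Δ) :=
  decidable_of_iff (∀ v, Even (G.deg Δ v)) Iff.rfl

/-- Vertices of the subgraph generated by the edge set `Δ`. -/
def verts (Δ : Finset E) : Finset V :=
  Finset.univ.filter (fun v => ∃ e ∈ Δ, v ∈ G.ends e)

/-- Adjacency through an edge of `Δ`. -/
def Adj (Δ : Finset E) (v w : V) : Prop := ∃ e ∈ Δ, G.ends e = s(v, w)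

/-- Connectedness relation of the subgraph with edge set `Δ`. -/
def Reach (Δ : Finset E) : V → V → Prop := Relation.ReflTransGen (G.Adj Δ)

/-- Number of connected components of the subgraph generated by `Δ`
(only vertices incident to an edge of `Δ` are taken into account). -/
noncomputable def ncomp (Δ : Finset E) : ℕ :=
  Set.ncard { S : Set V | ∃ v ∈ G.verts Δ, S = {w | G.Reach Δ v w} }

/-- Number of connected components of the spanning subgraph `(V, Δ)`. -/
noncomputable def ncompSpanning (Δ : Finset E) : ℕ :=
  Set.ncard { S : Set V | ∃ v : V, S = {w | G.Reach Δ v w} }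

/-- First Betti number `|E(Δ)| - |V(Δ)| + c(Δ)` of the subgraph generated by `Δ`. -/
noncomputable def b1 (Δ : Finset E) : ℤ :=
  (Δ.card : ℤ) - (G.verts Δ).card + G.ncomp Δ

/-- The set of cyclic Betti numbers `B_Γ = {b₁(Δ) | Δ cyclic}`. -/
noncomputable def B : Set ℤ := { n | ∃ Δ : Finset E, G.IsCyclic Δ ∧ G.b1 Δ = n }

/-- The boundary of an `𝔽₂` 1-chain: an edge is sent to the sum of its endpoints
(so a loop is sent to `0`). -/
def bndFun (x : E → ZMod 2) (v : V) : ZMod 2 :=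
  ∑ e : E, x e * (if (G.ends e).IsDiag then 0 else if v ∈ G.ends e then 1 else 0)

/-- The boundary operator as an `𝔽₂`-linear map. -/
def bnd : (E → ZMod 2) →ₗ[ZMod 2] (V → ZMod 2) where
  toFun := G.bndFun
  map_add' x y := by
    funext v
    simp only [bndFun, Pi.add_apply, ← Finset.sum_add_distrib]
    exact Finset.sum_congr rfl fun e _ => by ring
  map_smul' c x := by
    funext v
    simp only [bndFun, Pi.smul_apply, smul_eq_mul, Finset.mul_sum, RingHom.id_apply]
    exact Finset.sum_congr rfl fun e _ => by ring

/-- The cycle space `𝒞_Γ = ker ∂`. -/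
def cycleSpace : Submodule (ZMod 2) (E → ZMod 2) := LinearMap.ker G.bnd

/-- The `𝔽₂` 1-chain associated to a set of edges. -/
def chainOf (Δ : Finset E) : E → ZMod 2 := fun e => if e ∈ Δ then 1 else 0

/-- Chains supported on a subset `E'` of the edges. -/
def supportedOn (E' : Finset E) : Submodule (ZMod 2) (E → ZMod 2) where
  carrier := {x | ∀ e, e ∉ E' → x e = 0}
  add_mem' := by intro x y hx hy e he; simp [hx e he, hy e he]
  zero_mem' := by intro e he; rfl
  smul_mem' := by intro c x hx e he; simp [hx e he]

/-- The cycle space of the subgraph of `G` with edge set `E'`. -/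
def cycleSpaceOn (E' : Finset E) : Submodule (ZMod 2) (E → ZMod 2) :=
  G.cycleSpace ⊓ supportedOn E'

/-- The set of cyclic Betti numbers of the subgraph with edge set `E'`. -/
noncomputable def BOn (E' : Finset E) : Set ℤ :=
  { n | ∃ Δ ⊆ E', G.IsCyclic Δ ∧ G.b1 Δ = n }

/-- `N` is a separating edge: deleting it increases the number of connected components. -/
def Separating (N : E) : Prop :=
  G.ncompSpanning Finset.univ < G.ncompSpanning (Finset.univ \ {N})

/-- `G` is eulerian: every valency is even. -/
def Eulerian : Prop := ∀ v, Even (G.deg Finset.univ v)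

/-- `G` is superstable: every vertex has valency at least `3`, except possibly
a vertex carrying a loop. -/
def Superstable : Prop :=
  ∀ v ∈ G.verts Finset.univ, 3 ≤ G.deg Finset.univ v ∨ ∃ e : E, G.ends e = Sym2.diag v

/-- A circuit: a nonempty connected subgraph all of whose valencies equal `2`. -/
def IsCircuit (Δ : Finset E) : Prop :=
  Δ.Nonempty ∧ (∀ v ∈ G.verts Δ, G.deg Δ v = 2) ∧
    ∀ v ∈ G.verts Δ, ∀ w ∈ G.verts Δ, G.Reach Δ v w

/-- `G` is connected. -/
def Conn : Prop :=
  ∀ v ∈ G.verts Finset.univ, ∀ w ∈ G.verts Finset.univ, G.Reach Finset.univ v w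

/-- The edges of `G` that are not separating. -/
noncomputable def nonSepEdges : Finset E :=
  @Finset.filter _ (fun N => ¬ G.Separating N) (Classical.decPred _) Finset.univ

end Multigraph

namespace Multigraph

section

variable {V E : Type} (G : Multigraph V E)

theorem Reach.symm {G : Multigraph V E} {Δ : Finset E} {v w : V} (h : G.Reach Δ v w) :
    G.Reach Δ w v := by
  have : Std.Symm (G.Adj Δ) := ⟨fun _ _ ⟨e, he, h⟩ => ⟨e, he, h.trans Sym2.eq_swap⟩⟩
  exact Relation.ReflTransGen.stdSymm.symm _ _ h

theorem Reach.mono {G : Multigraph V E} {Δ Δ' : Finset E} (hΔ : Δ ⊆ Δ') {v w : V}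
    (h : G.Reach Δ v w) : G.Reach Δ' v w :=
  Relation.ReflTransGen.mono (r := G.Adj Δ) (fun _ _ ⟨e, he, h⟩ => ⟨e, hΔ he, h⟩) _ _ h

theorem reach_class_eq_iff (Δ : Finset E) (v w : V) :
    {x | G.Reach Δ v x} = {x | G.Reach Δ w x} ↔ G.Reach Δ v w := by
  constructor
  · intro h
    have hw : w ∈ {x | G.Reach Δ w x} := Relation.ReflTransGen.refl
    rwa [← h] at hw
  · intro h
    ext x
    exact ⟨fun hx => h.symm.trans hx, fun hx => h.trans hx⟩

/-- A walk using one additional edge `e` either avoids it or crosses it. -/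
theorem Reach.of_insert [DecidableEq E] {G : Multigraph V E} {Δ : Finset E} {e : E} {a b : V}
    (he : G.ends e = s(a, b)) {v w : V} (h : G.Reach (insert e Δ) v w) :
    G.Reach Δ v w ∨ (G.Reach Δ v a ∧ G.Reach Δ b w) ∨ (G.Reach Δ v b ∧ G.Reach Δ a w) := by
  induction h with
  | refl => exact Or.inl Relation.ReflTransGen.refl
  | @tail x y _ hxy ih =>
    obtain ⟨f, hf, hfe⟩ := hxy
    rcases Finset.mem_insert.1 hf with rfl | hf
    · rw [he, Sym2.eq_iff] at hfe
      have hra : G.Reach Δ a a := Relation.ReflTransGen.refl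
      have hrb : G.Reach Δ b b := Relation.ReflTransGen.refl
      rcases hfe with ⟨rfl, rfl⟩ | ⟨rfl, rfl⟩ <;> tauto
    · have hs : G.Reach Δ x y := Relation.ReflTransGen.single ⟨f, hf, hfe⟩
      rcases ih with h | ⟨h, h'⟩ | ⟨h, h'⟩
      · exact Or.inl (h.trans hs)
      · exact Or.inr (Or.inl ⟨h, h'.trans hs⟩)
      · exact Or.inr (Or.inr ⟨h, h'.trans hs⟩)

theorem not_reach_of_separating [Fintype E] [DecidableEq E] {G : Multigraph V E} {e : E} {a b : V}
    (he : G.ends e = s(a, b)) (hs : G.Separating e) :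
    ¬ G.Reach (Finset.univ \ {e}) a b := by
  intro hab
  refine hs.ne ?_
  have key : ∀ v w, G.Reach Finset.univ v w ↔ G.Reach (Finset.univ \ {e}) v w := by
    refine fun v w => ⟨fun h => ?_, Reach.mono (Finset.subset_univ _)⟩
    have hu : insert e (Finset.univ \ {e}) = Finset.univ := by
      ext x
      simp
    rw [← hu] at h
    rcases h.of_insert he with h | ⟨h, h'⟩ | ⟨h, h'⟩
    · exact h
    · exact (h.trans hab).trans h'
    · exact (h.trans hab.symm).trans h'
  simp only [ncompSpanning, key]

theorem ncompSpanning_le_insert [Finite V] [DecidableEq E] (Δ : Finset E) (e : E) :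
    G.ncompSpanning Δ ≤ G.ncompSpanning (insert e Δ) + 1 := by
  obtain ⟨a, b, he⟩ : ∃ a b, G.ends e = s(a, b) := by
    induction h : G.ends e with
    | h a b => exact ⟨a, b, rfl⟩
  set T : Set (Set V) := {S | ∃ v, S = {w | G.Reach Δ v w}} with hT
  have h1 : (T \ {{w | G.Reach Δ b w}}).ncard ≤ G.ncompSpanning (insert e Δ) := by
    refine Set.ncard_le_ncard_of_injOn
      (fun S => {w | ∃ v ∈ S, G.Reach (insert e Δ) v w}) ?_ ?_ (Set.toFinite _)
    · rintro _ ⟨⟨v, rfl⟩, -⟩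
      refine ⟨v, ?_⟩
      ext w
      constructor
      · rintro ⟨x, hx, hxw⟩
        exact (Reach.mono (Finset.subset_insert _ _) hx).trans hxw
      · exact fun h => ⟨v, Relation.ReflTransGen.refl, h⟩
    · rintro _ ⟨⟨v, rfl⟩, hv⟩ _ ⟨⟨w, rfl⟩, hw⟩ h
      rw [Set.mem_singleton_iff, reach_class_eq_iff] at hv hw
      have hmem : w ∈ {x | ∃ y ∈ {z | G.Reach Δ w z}, G.Reach (insert e Δ) y x} :=
        ⟨w, Relation.ReflTransGen.refl, Relation.ReflTransGen.refl⟩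
      rw [← show {x | ∃ y ∈ {z | G.Reach Δ v z}, G.Reach (insert e Δ) y x} =
        {x | ∃ y ∈ {z | G.Reach Δ w z}, G.Reach (insert e Δ) y x} from h] at hmem
      obtain ⟨y, hy, hyw⟩ := hmem
      have hvw := (Reach.mono (Finset.subset_insert e Δ) hy).trans hyw
      rw [reach_class_eq_iff]
      rcases Reach.of_insert he hvw with h | ⟨-, h⟩ | ⟨h, -⟩
      · exact h
      · exact absurd h.symm hw
      · exact absurd h hv
  have h2 := Set.pred_ncard_le_ncard_sdiff_singleton T {w | G.Reach Δ b w}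
  have h3 : G.ncompSpanning Δ = T.ncard := rfl
  omega

theorem ncompSpanning_le_of_subset [Finite V] [DecidableEq E] {Δ Δ' : Finset E} (h : Δ ⊆ Δ') :
    G.ncompSpanning Δ + Δ.card ≤ G.ncompSpanning Δ' + Δ'.card := by
  rw [← Finset.union_sdiff_of_subset h]
  induction Δ' \ Δ using Finset.induction_on with
  | empty => simp
  | insert e A _ ih =>
    rw [Finset.union_insert]
    by_cases he : e ∈ Δ ∪ A
    · rwa [Finset.insert_eq_of_mem he]
    · have := G.ncompSpanning_le_insert (Δ ∪ A) e
      rw [Finset.card_insert_of_notMem he]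
      omega

theorem sum_deg [DecidableEq V] (Δ : Finset E) (C : Finset V) :
    ∑ v ∈ C, G.deg Δ v = ∑ e ∈ Δ, Multiset.countP (· ∈ C) (G.ends e).toMultiset := by
  simp only [deg]
  rw [Finset.sum_comm]
  refine Finset.sum_congr rfl fun e _ => ?_
  induction G.ends e with
  | h x y =>
    have h : ∀ v, (if s(x, y) = Sym2.diag v then 2 else if v ∈ s(x, y) then 1 else 0) =
        (if x = v then 1 else 0) + (if y = v then 1 else 0) := by
      intro v
      by_cases hx : x = v <;> by_cases hy : y = v <;>
        simp [Sym2.diag, hx, hy, eq_comm (a := v)]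
    simp only [h, Finset.sum_add_distrib, Finset.sum_ite_eq]
    by_cases hx : x ∈ C <;> by_cases hy : y ∈ C <;>
      simp [Sym2.toMultiset, hx, hy]

end

variable {V E : Type} [Fintype V] [DecidableEq V] (G : Multigraph V E)

theorem eq_of_reach_of_notMem_verts {G : Multigraph V E} {Δ : Finset E} {v w : V}
    (hv : v ∉ G.verts Δ) (h : G.Reach Δ v w) : v = w := by
  rcases Relation.ReflTransGen.cases_head h with h | ⟨x, ⟨e, he, hx⟩, -⟩
  · exact h
  · refine absurd ?_ hv
    simp only [verts, Finset.mem_filter, Finset.mem_univ, true_and]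
    exact ⟨e, he, hx ▸ Sym2.mem_mk_left v x⟩

theorem ncompSpanning_eq (Δ : Finset E) :
    G.ncompSpanning Δ = G.ncomp Δ + (G.verts Δ)ᶜ.card := by
  have hsing : ∀ v ∉ G.verts Δ, {w | G.Reach Δ v w} = {v} := by
    intro v hv
    ext w
    constructor
    · exact fun h => (eq_of_reach_of_notMem_verts hv h).symm
    · rintro rfl
      exact Relation.ReflTransGen.refl
  have hunion : {S : Set V | ∃ v : V, S = {w | G.Reach Δ v w}} =
      {S : Set V | ∃ v ∈ G.verts Δ, S = {w | G.Reach Δ v w}} ∪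
        (fun v => ({v} : Set V)) '' ((G.verts Δ)ᶜ : Finset V) := by
    ext S
    constructor
    · rintro ⟨v, rfl⟩
      by_cases hv : v ∈ G.verts Δ
      · exact Or.inl ⟨v, hv, rfl⟩
      · exact Or.inr ⟨v, by simpa using hv, (hsing v hv).symm⟩
    · rintro (⟨v, -, rfl⟩ | ⟨v, hv, rfl⟩)
      · exact ⟨v, rfl⟩
      · exact ⟨v, (hsing v (by simpa using hv)).symm⟩
  have hdisj : Disjoint {S : Set V | ∃ v ∈ G.verts Δ, S = {w | G.Reach Δ v w}}
      ((fun v => ({v} : Set V)) '' ((G.verts Δ)ᶜ : Finset V)) := by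
    rw [Set.disjoint_left]
    rintro _ ⟨v, hv, rfl⟩ ⟨w, hw, h⟩
    have hmem : v ∈ ({w} : Set V) := by
      rw [show ({w} : Set V) = _ from h]
      exact Relation.ReflTransGen.refl
    rw [Set.mem_singleton_iff] at hmem
    subst hmem
    simp [hv] at hw
  rw [ncompSpanning, hunion, Set.ncard_union_eq hdisj (Set.toFinite _) (Set.toFinite _),
    Set.ncard_image_of_injective _ Set.singleton_injective, Set.ncard_coe_finset, ncomp]

theorem b1_eq (Δ : Finset E) :
    G.b1 Δ = (Δ.card : ℤ) - Fintype.card V + G.ncompSpanning Δ := by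
  have h := Finset.card_add_card_compl (G.verts Δ)
  rw [b1, ncompSpanning_eq]
  push_cast
  omega

theorem eq_univ_of_b1_eq [Fintype E] [DecidableEq E] {G : Multigraph V E}
    (hsep : ∀ e, ¬ G.Separating e) {Δ : Finset E} (h : G.b1 Δ = G.b1 Finset.univ) :
    Δ = Finset.univ := by
  refine Finset.eq_univ_of_forall fun e => ?_
  by_contra he
  have hsub : Δ ⊆ Finset.univ \ {e} := by
    intro x hx
    simp only [Finset.mem_sdiff, Finset.mem_univ, true_and, Finset.mem_singleton]
    rintro rfl
    exact he hx
  have h1 := G.ncompSpanning_le_of_subset hsub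
  have h2 := not_lt.1 (hsep e)
  have h3 := Finset.card_sdiff_add_card_eq_card (Finset.subset_univ {e})
  rw [Finset.card_singleton] at h3
  rw [b1_eq, b1_eq] at h
  omega

theorem Eulerian.not_separating [Fintype E] [DecidableEq E] {G : Multigraph V E}
    (h : G.Eulerian) (e : E) : ¬ G.Separating e := by
  classical
  intro hs
  obtain ⟨a, b, he⟩ : ∃ a b, G.ends e = s(a, b) := by
    induction h : G.ends e with
    | h a b => exact ⟨a, b, rfl⟩
  have hab := not_reach_of_separating he hs
  set C : Finset V := {v | G.Reach (Finset.univ \ {e}) a v} with hC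
  have ha : a ∈ C := Finset.mem_filter.2 ⟨Finset.mem_univ a, Relation.ReflTransGen.refl⟩
  have hb : b ∉ C := by simpa [hC] using hab
  have heven : Even (∑ v ∈ C, G.deg Finset.univ v) := Finset.even_sum _ fun v _ => h v
  rw [sum_deg, ← Finset.sum_sdiff (Finset.subset_univ {e}), Finset.sum_singleton, he] at heven
  have hone : Multiset.countP (· ∈ C) s(a, b).toMultiset = 1 := by
    simp [Sym2.toMultiset, ha, hb]
  rw [hone] at heven
  refine Nat.not_even_iff_odd.2 (Even.add_one (Finset.even_sum _ fun f hf => ?_)) heven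
  induction hxy : G.ends f with
  | h x y =>
    have hadj : G.Reach (Finset.univ \ {e}) x y := Relation.ReflTransGen.single ⟨f, hf, hxy⟩
    have hiff : x ∈ C ↔ y ∈ C := by
      simp only [hC, Finset.mem_filter, Finset.mem_univ, true_and]
      exact ⟨fun h => h.trans hadj, fun h => h.trans hadj.symm⟩
    by_cases hy : y ∈ C <;> simp [Sym2.toMultiset, hiff, hy]

end Multigraph

/-- A finite multigraph without isolated vertices is eulerian iff it has no
separating edges and `b₁(Γ) ∈ B_Γ`. -/
theorem eulerian_iff {V E : Type} [Fintype V] [Fintype E]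
    [DecidableEq V] [DecidableEq E] (G : Multigraph V E)
    (hni : ∀ v : V, ∃ e : E, v ∈ G.ends e) :
    G.Eulerian ↔ (∀ N : E, ¬ G.Separating N) ∧ G.b1 Finset.univ ∈ G.B := by
  refine ⟨fun h => ⟨h.not_separating, Finset.univ, h, rfl⟩, ?_⟩
  rintro ⟨hsep, Δ, hΔ, hb⟩
  rwa [Multigraph.eq_univ_of_b1_eq hsep hb] at hΔ
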